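/- arXiv:2402.00957 — 2 statements merged into one kernel-verified Lean document; each statement's English description precedes it below -/
import Mathlib

section
/- Let 𝒫 = conv{P_1,…,P_m} be a finitely generated credal set of probability measures on Z, let P, Q ∈ 𝒫 with d_TV(P,Q) ≤ η for some η > 0, let H be a finite nonempty hypothesis class with measurable error sets, assume realizability with respect to P (there exists h* ∈ H with L_P(h*) = 0), and let ĥ be an empirical risk minimizer on samples of size n ≥ 1 drawn i.i.d. from P. Then for every ε > 0, writing B_j(ε) = {h ∈ H : L_{P_j}(h) > ε}, one has P^{⊗n}({s ∈ Z^n : L_Q(ĥ(s)) > ε + η}) ≤ |⋃_{j=1}^m B_j(ε)| · exp(−ε n). -/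
open MeasureTheory Finset
open scoped ENNReal NNReal Classical

variable {X Y : Type*}

/-- The error set of hypothesis `h : X → Y`. -/
def errSet (h : X → Y) : Set (X × Y) := {p | p.2 ≠ h p.1}

variable [MeasurableSpace X] [MeasurableSpace Y]

/-- Expected risk of `h` under `P` with the zero-one loss: `L_P(h) = P(A_h)`. -/
noncomputable def risk (P : Measure (X × Y)) (h : X → Y) : ℝ := (P (errSet h)).toReal

/-- Empirical risk of `h` on the sample `s` of size `n`. -/
noncomputable def empRisk {n : ℕ} (s : Fin n → X × Y) (h : X → Y) : ℝ :=
  ((Finset.univ.filter fun i => (s i).2 ≠ h (s i).1).card : ℝ) / n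

/-- `A` is an empirical risk minimizer over the hypothesis class `H`. -/
def IsERM {n : ℕ} (H : Finset (X → Y)) (A : (Fin n → X × Y) → (X → Y)) : Prop :=
  ∀ s, A s ∈ H ∧ ∀ h ∈ H, empRisk s (A s) ≤ empRisk s h

/-- Measurability of a hypothesis-valued map (sufficient notion since `H` is finite). -/
def MeasurableERM {n : ℕ} (A : (Fin n → X × Y) → (X → Y)) : Prop :=
  ∀ h : X → Y, MeasurableSet {s | A s = h}

/-- Membership in the finitely generated credal set `conv{P_1, …, P_m}`. -/
def memCredal {Z : Type*} [MeasurableSpace Z] {m : ℕ} (Pm : Fin m → Measure Z)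
    (P : Measure Z) : Prop :=
  ∃ w : Fin m → ℝ≥0, (∑ j, w j = 1) ∧ P = ∑ j, (w j : ℝ≥0∞) • Pm j

/-- Total variation distance between measures. -/
noncomputable def dTV {Z : Type*} [MeasurableSpace Z] (P Q : Measure Z) : ℝ :=
  ⨆ A : {A : Set Z // MeasurableSet A}, |(P A.1).toReal - (Q A.1).toReal|

/-- Rademacher complexity of the zero-one loss class of `H` at sample size `n` under `P`. -/
noncomputable def rademacher (n : ℕ) (P : Measure (X × Y)) (H : Finset (X → Y)) : ℝ :=
  ∫ p : (Fin n → X × Y) × (Fin n → Bool),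
    (⨆ h : H, (∑ i, (if p.2 i then (1 : ℝ) else -1) *
      (if (p.1 i).2 ≠ (h : X → Y) (p.1 i).1 then 1 else 0)) / n)
    ∂((Measure.pi fun _ => P).prod (Measure.pi fun _ => (PMF.uniformOfFintype Bool).toMeasure))

/-- The mass of a measurable set differs between two probability measures by at most their
total variation distance. -/
theorem toReal_le_add_dTV {Z : Type*} [MeasurableSpace Z] (P Q : Measure Z)
    [IsProbabilityMeasure P] [IsProbabilityMeasure Q] {A : Set Z} (hA : MeasurableSet A) :
    (Q A).toReal ≤ (P A).toReal + dTV P Q := by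
  have hbdd : BddAbove (Set.range fun A : {A : Set Z // MeasurableSet A} =>
      |(P A.1).toReal - (Q A.1).toReal|) := by
    refine ⟨1, ?_⟩
    rintro _ ⟨B, rfl⟩
    have hP0 : 0 ≤ (P B.1).toReal := ENNReal.toReal_nonneg
    have hQ0 : 0 ≤ (Q B.1).toReal := ENNReal.toReal_nonneg
    have hP1 : (P B.1).toReal ≤ 1 := measureReal_le_one
    have hQ1 : (Q B.1).toReal ≤ 1 := measureReal_le_one
    exact abs_le.2 ⟨by linarith, by linarith⟩
  have hle : |(P A).toReal - (Q A).toReal| ≤ dTV P Q := le_ciSup hbdd ⟨A, hA⟩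
  linarith [neg_le_of_abs_le hle]

/-- If a member of a credal set gives a set mass more than `ε`, so does one of the generators. -/
theorem exists_lt_toReal_of_memCredal {Z : Type*} [MeasurableSpace Z] {m : ℕ}
    {Pm : Fin m → Measure Z} (hPm : ∀ j, IsProbabilityMeasure (Pm j)) {P : Measure Z}
    (hP : memCredal Pm P) {A : Set Z} {ε : ℝ} (h : ε < (P A).toReal) :
    ∃ j, ε < (Pm j A).toReal := by
  obtain ⟨w, hw, rfl⟩ := hP
  by_contra! hle
  refine h.not_ge ?_
  have hsum : ((∑ j, (w j : ℝ≥0∞) • Pm j) A).toReal = ∑ j, (w j : ℝ) * (Pm j A).toReal := by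
    simp only [Measure.coe_finsetSum, Finset.sum_apply, Measure.smul_apply, smul_eq_mul]
    rw [ENNReal.toReal_sum fun j _ => ENNReal.mul_ne_top ENNReal.coe_ne_top (measure_ne_top _ _)]
    simp
  have hw' : ∑ j, (w j : ℝ) = 1 := by exact_mod_cast hw
  calc ((∑ j, (w j : ℝ≥0∞) • Pm j) A).toReal = ∑ j, (w j : ℝ) * (Pm j A).toReal := hsum
    _ ≤ ∑ j, (w j : ℝ) * ε := by gcongr with j; exact hle j
    _ = ε := by rw [← Finset.sum_mul, hw', one_mul]

/-- An i.i.d. sample of size `n` avoids a set of mass more than `ε` with probability at most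
`exp (-ε n)`. -/
theorem pi_forall_notMem_le_exp {Z : Type*} [MeasurableSpace Z] (n : ℕ) (P : Measure Z)
    [IsProbabilityMeasure P] {A : Set Z} (hA : MeasurableSet A) {ε : ℝ}
    (h : ε < (P A).toReal) :
    (Measure.pi fun _ : Fin n => P) {s | ∀ i, s i ∉ A}
      ≤ ENNReal.ofReal (Real.exp (-ε * n)) := by
  have hset : {s : Fin n → Z | ∀ i, s i ∉ A} = Set.univ.pi fun _ => Aᶜ := by
    ext s; simp
  have hcompl : P Aᶜ = ENNReal.ofReal (1 - (P A).toReal) := by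
    rw [← ENNReal.ofReal_toReal (measure_ne_top P Aᶜ)]
    exact congrArg ENNReal.ofReal (probReal_compl_eq_one_sub hA)
  have hexp : 1 - (P A).toReal ≤ Real.exp (-ε) := by
    linarith [Real.add_one_le_exp (-ε)]
  rw [hset, Measure.pi_pi, Finset.prod_const, Finset.card_univ, Fintype.card_fin, hcompl,
    mul_comm, Real.exp_nat_mul, ENNReal.ofReal_pow (Real.exp_pos _).le]
  gcongr

/-- The empirical risk on a nonempty sample vanishes exactly when no sample point is an error. -/
theorem empRisk_eq_zero_iff {X Y : Type*} {n : ℕ} (hn : 1 ≤ n) (s : Fin n → X × Y) (h : X → Y) :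
    empRisk s h = 0 ↔ ∀ i, s i ∉ errSet h := by
  have hn' : (n : ℝ) ≠ 0 := by positivity
  simp [empRisk, errSet, hn', Finset.filter_eq_empty_iff]

/-- Under a distribution with respect to which a hypothesis has zero risk, its empirical risk
vanishes almost surely. -/
theorem ae_forall_notMem_errSet {X Y : Type*} [MeasurableSpace X] [MeasurableSpace Y] (n : ℕ)
    (P : Measure (X × Y)) [IsProbabilityMeasure P] {h : X → Y} (hrisk : risk P h = 0) :
    ∀ᵐ s ∂(Measure.pi fun _ : Fin n => P), ∀ i, s i ∉ errSet h := by
  have hzero : P (errSet h) = 0 :=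
    (ENNReal.toReal_eq_zero_iff _).1 hrisk |>.resolve_right (measure_ne_top _ _)
  refine ae_all_iff.2 fun i => ?_
  exact (Measure.quasiMeasurePreserving_eval (μ := fun _ : Fin n => P) i).ae
    (measure_eq_zero_iff_ae_notMem.1 hzero)

/-- Credal realizable bound for a nearby distribution `Q` (Corollary on TV-diameter). -/
theorem credal_realizable_bound_tv {m n : ℕ} (hm : 0 < m) (hn : 1 ≤ n)
    (Pm : Fin m → Measure (X × Y)) (hPm : ∀ j, IsProbabilityMeasure (Pm j))
    (P Q : Measure (X × Y)) [IsProbabilityMeasure P] [IsProbabilityMeasure Q]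
    (hP : memCredal Pm P) (hQ : memCredal Pm Q)
    (η : ℝ) (hη : 0 < η) (hTV : dTV P Q ≤ η)
    (H : Finset (X → Y)) (hH : H.Nonempty)
    (hmeas : ∀ h ∈ H, MeasurableSet (errSet h))
    (hreal : ∃ hstar ∈ H, risk P hstar = 0)
    (erm : (Fin n → X × Y) → (X → Y)) (hermM : MeasurableERM erm) (herm : IsERM H erm)
    (ε : ℝ) (hε : 0 < ε) :
    (Measure.pi fun _ : Fin n => P) {s | risk Q (erm s) > ε + η}
      ≤ ((Finset.univ.biUnion fun j : Fin m =>
            H.filter fun h => risk (Pm j) h > ε).card : ℝ≥0∞)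
        * ENNReal.ofReal (Real.exp (-ε * n)) := by
  obtain ⟨hstar, hstarH, hstar0⟩ := hreal
  set B := Finset.univ.biUnion fun j : Fin m => H.filter fun h => risk (Pm j) h > ε
  set μ := Measure.pi fun _ : Fin n => P
  set C := H.filter fun h => risk P h > ε
  have hCB : C ⊆ B := by
    intro h hh
    obtain ⟨hhH, hlt⟩ := Finset.mem_filter.1 hh
    obtain ⟨j, hj⟩ := exists_lt_toReal_of_memCredal hPm hP hlt
    exact Finset.mem_biUnion.2 ⟨j, Finset.mem_univ j, Finset.mem_filter.2 ⟨hhH, hj⟩⟩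
  have hsub : {s | risk Q (erm s) > ε + η} ≤ᵐ[μ] ⋃ h ∈ C, {s | ∀ i, s i ∉ errSet h} := by
    filter_upwards [ae_forall_notMem_errSet n P hstar0] with s hs hlt
    obtain ⟨hermH, hmin⟩ := herm s
    have hlt' : risk Q (erm s) > ε + η := hlt
    have hle : risk Q (erm s) ≤ risk P (erm s) + dTV P Q :=
      toReal_le_add_dTV P Q (hmeas _ hermH)
    have hemp : empRisk s (erm s) = 0 := by
      refine le_antisymm ((hmin hstar hstarH).trans_eq ((empRisk_eq_zero_iff hn s hstar).2 hs)) ?_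
      unfold empRisk
      positivity
    exact Set.mem_iUnion₂.2 ⟨erm s, Finset.mem_filter.2 ⟨hermH, by linarith⟩,
      (empRisk_eq_zero_iff hn s _).1 hemp⟩
  calc μ {s | risk Q (erm s) > ε + η}
      ≤ μ (⋃ h ∈ C, {s | ∀ i, s i ∉ errSet h}) := measure_mono_ae hsub
    _ ≤ ∑ h ∈ C, μ {s | ∀ i, s i ∉ errSet h} := measure_biUnion_finset_le _ _
    _ ≤ ∑ _h ∈ C, ENNReal.ofReal (Real.exp (-ε * n)) := by
        refine Finset.sum_le_sum fun h hh => ?_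
        obtain ⟨hhH, hlt⟩ := Finset.mem_filter.1 hh
        exact pi_forall_notMem_le_exp n P (hmeas h hhH) hlt
    _ = (C.card : ℝ≥0∞) * ENNReal.ofReal (Real.exp (-ε * n)) := by
        rw [Finset.sum_const, nsmul_eq_mul]
    _ ≤ (B.card : ℝ≥0∞) * ENNReal.ofReal (Real.exp (-ε * n)) := by
        gcongr
end

section
/- Let P be a probability measure on Z, let H be a finite nonempty hypothesis class with measurable error sets, let ĥ be an empirical risk minimizer on samples of size n ≥ 1, and let h* ∈ H minimize L_P over H. Then for every δ ∈ (0,1), P^{⊗n}({s ∈ Z^n : L_P(ĥ(s)) − L_P(h*) ≤ 4·R_{n,P}(H) + √(2 log(2/δ)/n)}) ≥ 1 − δ. -/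
open MeasureTheory Finset
open scoped ENNReal NNReal Classical

variable {X Y : Type*}

variable [MeasurableSpace X] [MeasurableSpace Y]

open ProbabilityTheory in
/-- If the conditional mean and the conditional fluctuations of a bounded function on a product
space are sub-Gaussian, then so is the function itself. -/
lemma hasSubgaussianMGF_prod {α β : Type*} [MeasurableSpace α] [MeasurableSpace β]
    {μ : Measure α} {ν : Measure β} [IsProbabilityMeasure μ] [IsProbabilityMeasure ν]
    {F : α × β → ℝ} (hF : Measurable F) {C : ℝ} (hC : ∀ p, |F p| ≤ C) {m : ℝ} {c₁ c₂ : ℝ≥0}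
    (h₁ : HasSubgaussianMGF (fun x => ∫ y, F (x, y) ∂ν - m) c₁ μ)
    (h₂ : ∀ x, HasSubgaussianMGF (fun y => F (x, y) - ∫ y, F (x, y) ∂ν) c₂ ν) :
    HasSubgaussianMGF (fun p => F p - m) (c₁ + c₂) (μ.prod ν) := by
  have hint : ∀ t, Integrable (fun p => Real.exp (t * (F p - m))) (μ.prod ν) := fun t =>
    integrable_exp_mul_of_mem_Icc (a := -C - m) (b := C - m) (by fun_prop)
      (.of_forall fun p => by have := abs_le.1 (hC p); constructor <;> linarith)
  refine ⟨hint, fun t => ?_⟩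
  calc mgf (fun p => F p - m) (μ.prod ν) t
      = ∫ x, ∫ y, Real.exp (t * (F (x, y) - m)) ∂ν ∂μ := integral_prod _ (hint t)
    _ ≤ ∫ x, Real.exp (t * (∫ y, F (x, y) ∂ν - m)) * Real.exp (c₂ * t ^ 2 / 2) ∂μ := by
        refine integral_mono (hint t).integral_prod_left
          ((h₁.integrable_exp_mul t).mul_const _) fun x => ?_
        have hsplit : ∀ y, Real.exp (t * (F (x, y) - m))
            = Real.exp (t * (∫ y, F (x, y) ∂ν - m))
              * Real.exp (t * (F (x, y) - ∫ y, F (x, y) ∂ν)) := fun y => by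
          rw [← Real.exp_add]; ring_nf
        simp_rw [hsplit]
        rw [integral_const_mul]
        exact mul_le_mul_of_nonneg_left ((h₂ x).mgf_le t) (Real.exp_pos _).le
    _ ≤ Real.exp (c₁ * t ^ 2 / 2) * Real.exp (c₂ * t ^ 2 / 2) := by
        rw [integral_mul_const]
        exact mul_le_mul_of_nonneg_right (h₁.mgf_le t) (Real.exp_pos _).le
    _ = Real.exp ((c₁ + c₂ : ℝ≥0) * t ^ 2 / 2) := by
        rw [← Real.exp_add]; push_cast; ring_nf

open ProbabilityTheory in
/-- A bounded random variable with oscillation at most `c` is sub-Gaussian. -/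
lemma hasSubgaussianMGF_of_sub_le {α : Type*} [MeasurableSpace α] {μ : Measure α}
    [IsProbabilityMeasure μ] {g : α → ℝ} (hg : Measurable g) {C : ℝ} (hC : ∀ x, |g x| ≤ C)
    {c : ℝ≥0} (hc : ∀ x y, g x - g y ≤ c) :
    HasSubgaussianMGF (fun x => g x - ∫ y, g y ∂μ) ((c / 2) ^ 2) μ := by
  have : Nonempty α := μ.nonempty_of_neZero
  have hbdd : BddBelow (Set.range g) := ⟨-C, by rintro _ ⟨x, rfl⟩; exact (abs_le.1 (hC x)).1⟩
  have h := hasSubgaussianMGF_of_mem_Icc (a := ⨅ x, g x) (b := (⨅ x, g x) + c)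
    hg.aemeasurable (μ := μ) (.of_forall fun x => ⟨ciInf_le hbdd x, by
      have : g x - c ≤ ⨅ x, g x := le_ciInf fun y => by linarith [hc x y]
      linarith⟩)
  simpa using h

open ProbabilityTheory in
/-- **McDiarmid's inequality**, moment generating function form. -/
lemma hasSubgaussianMGF_of_bounded_differences {Z : Type*} [MeasurableSpace Z] (P : Measure Z)
    [IsProbabilityMeasure P] {n : ℕ} {f : (Fin n → Z) → ℝ} (hf : Measurable f)
    {C : ℝ} (hC : ∀ s, |f s| ≤ C) (c : Fin n → ℝ≥0)
    (hc : ∀ s i z, f (Function.update s i z) - f s ≤ c i) :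
    HasSubgaussianMGF (fun s => f s - ∫ s, f s ∂(Measure.pi fun _ => P))
      (∑ i, (c i / 2) ^ 2) (Measure.pi fun _ => P) := by
  induction n with
  | zero =>
    have h0 : (fun s => f s - ∫ s, f s ∂(Measure.pi fun _ => P)) = fun _ => 0 := by
      funext s
      have : f = fun _ => f s := funext fun s' => congrArg f (Subsingleton.elim _ _)
      rw [this]
      simp
    rw [h0]
    simp
  | succ n ih =>
    have he := (measurePreserving_piFinSuccAbove (fun _ : Fin (n + 1) => P) 0).symm
    set e := (MeasurableEquiv.piFinSuccAbove (fun _ : Fin (n + 1) => Z) 0).symm with he_def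
    have he_apply : ∀ z s, e (z, s) = Fin.cons z s := fun z s => by
      simp [he_def, MeasurableEquiv.piFinSuccAbove, Fin.consEquiv]
    have hF : Measurable fun p => f (e p) := hf.comp e.measurable
    have hFx : ∀ z, Measurable fun s => f (e (z, s)) := fun z => hF.comp (by fun_prop)
    have hFint : ∀ z, Integrable (fun s => f (e (z, s))) (Measure.pi fun _ : Fin n => P) :=
      fun z => .of_bound (hFx z).aestronglyMeasurable C (.of_forall fun s => hC _)
    have hint : ∫ s, f s ∂(Measure.pi fun _ : Fin (n + 1) => P)
        = ∫ z, ∫ s, f (e (z, s)) ∂(Measure.pi fun _ : Fin n => P) ∂P := by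
      rw [← he.integral_comp', integral_prod]
      exact .of_bound hF.aestronglyMeasurable C (.of_forall fun s => hC _)
    have h₁ : HasSubgaussianMGF (fun z => ∫ s, f (e (z, s)) ∂(Measure.pi fun _ : Fin n => P)
        - ∫ s, f s ∂(Measure.pi fun _ : Fin (n + 1) => P)) ((c 0 / 2) ^ 2) P := by
      rw [hint]
      refine hasSubgaussianMGF_of_sub_le (C := C)
        hF.stronglyMeasurable.integral_prod_right'.measurable (fun z => ?_) fun z z' => ?_
      · have := norm_integral_le_of_norm_le_const (μ := Measure.pi fun _ : Fin n => P)
          (f := fun s => f (e (z, s))) (C := C) (.of_forall fun s => hC _)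
        simpa using this
      · rw [← integral_sub (hFint z) (hFint z')]
        calc ∫ s, (f (e (z, s)) - f (e (z', s))) ∂(Measure.pi fun _ : Fin n => P)
            ≤ ∫ _, (c 0 : ℝ) ∂(Measure.pi fun _ : Fin n => P) := by
              refine integral_mono ((hFint z).sub (hFint z')) (integrable_const _) fun s => ?_
              have := hc (Fin.cons z' s) 0 z
              simpa [he_apply, Fin.update_cons_zero] using this
          _ = c 0 := by simp
    have h₂ : ∀ z, HasSubgaussianMGF (fun s => f (e (z, s))
        - ∫ s, f (e (z, s)) ∂(Measure.pi fun _ : Fin n => P))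
        (∑ i : Fin n, (c i.succ / 2) ^ 2) (Measure.pi fun _ => P) := fun z =>
      ih (hFx z) (fun s => hC _) (fun i => c i.succ) fun s i y => by
        have := hc (Fin.cons z s) i.succ y
        simpa [he_apply, Fin.cons_update] using this
    have h := hasSubgaussianMGF_prod hF (fun p => hC _) h₁ h₂
    rw [← Fin.sum_univ_succ (fun i => (c i / 2) ^ 2)] at h
    have h' : HasSubgaussianMGF (fun s => f s - ∫ s, f s ∂(Measure.pi fun _ : Fin (n + 1) => P))
        (∑ i, (c i / 2) ^ 2) ((P.prod (Measure.pi fun _ : Fin n => P)).map e) := by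
      refine ⟨fun t => ?_, fun t => ?_⟩
      · exact (integrable_map_equiv e _).2 (h.integrable_exp_mul t)
      · rw [mgf, integral_map_equiv]; exact h.mgf_le t
    rwa [he.map_eq] at h'

section Symmetrization

variable {ι Z : Type*} [Finite ι] [MeasurableSpace Z] {n : ℕ} {f : ι → Z → ℝ}

/-- The supremum over a class of functions of the weighted averages along a sample. -/
noncomputable def weightedSup (f : ι → Z → ℝ) (a : Fin n → ℝ) (s : Fin n → Z) : ℝ :=
  ⨆ h, (∑ i, a i * f h (s i)) / n

/-- The Rademacher sign attached to a Boolean. -/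
def boolSign (b : Bool) : ℝ := if b then 1 else -1

lemma abs_ciSup_le {κ : Type*} [Nonempty κ] {g : κ → ℝ} {C : ℝ} (hg : ∀ k, |g k| ≤ C) :
    |⨆ k, g k| ≤ C := by
  obtain ⟨k₀⟩ := ‹Nonempty κ›
  have hbdd : BddAbove (Set.range g) := ⟨C, by rintro _ ⟨k, rfl⟩; exact (abs_le.1 (hg k)).2⟩
  have : Nonempty κ := ⟨k₀⟩
  exact abs_le.2 ⟨(abs_le.1 (hg k₀)).1.trans (le_ciSup hbdd k₀),
    ciSup_le fun k => (abs_le.1 (hg k)).2⟩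

lemma abs_sum_div_le {x : Fin n → ℝ} {C : ℝ} (hC : 0 ≤ C) (hx : ∀ i, |x i| ≤ C) :
    |(∑ i, x i) / n| ≤ C := by
  rw [abs_div, Nat.abs_cast]
  refine div_le_of_le_mul₀ (by positivity) hC ((Finset.abs_sum_le_sum_abs _ _).trans ?_)
  calc ∑ i, |x i| ≤ ∑ _i : Fin n, C := sum_le_sum fun i _ => hx i
    _ = C * n := by simp [mul_comm]

lemma measurable_weightedSup (hf : ∀ h, Measurable (f h)) {α : Type*} [MeasurableSpace α]
    {a : α → Fin n → ℝ} {s : α → Fin n → Z} (ha : Measurable a) (hs : Measurable s) :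
    Measurable fun x => weightedSup f (a x) (s x) := by
  unfold weightedSup
  refine .iSup fun h => .div_const (Finset.measurable_sum _ fun i _ => .mul ?_ ?_) _
  · exact (measurable_pi_apply i).comp ha
  · exact (hf h).comp ((measurable_pi_apply i).comp hs)

omit [Finite ι] [MeasurableSpace Z] in
lemma abs_weightedSup_le [Nonempty ι] (hf1 : ∀ h z, |f h z| ≤ 1) {a : Fin n → ℝ}
    (ha : ∀ i, |a i| ≤ 1) (s : Fin n → Z) : |weightedSup f a s| ≤ 1 :=
  abs_ciSup_le fun h => abs_sum_div_le zero_le_one fun i => by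
    rw [abs_mul]; exact mul_le_one₀ (ha i) (abs_nonneg _) (hf1 h _)

lemma abs_boolSign (b : Bool) : |boolSign b| = 1 := by cases b <;> simp [boolSign]

lemma measurePreserving_not :
    MeasurePreserving (! ·) (PMF.uniformOfFintype Bool).toMeasure
      (PMF.uniformOfFintype Bool).toMeasure := by
  refine ⟨measurable_of_finite _, Measure.ext_of_singleton fun b => ?_⟩
  rw [Measure.map_apply (measurable_of_finite _) (measurableSet_singleton b)]
  have : (! ·) ⁻¹' {b} = {!b} := by ext x; cases x <;> cases b <;> simp
  rw [this, PMF.toMeasure_apply_singleton _ _ (measurableSet_singleton _),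
    PMF.toMeasure_apply_singleton _ _ (measurableSet_singleton _)]
  simp

lemma integral_comp_of_measurePreserving {α β : Type*} [MeasurableSpace α] [MeasurableSpace β]
    {μ : Measure α} {ν : Measure β} {T : α → β} (hT : MeasurePreserving T μ ν) {g : β → ℝ}
    (hg : Measurable g) : ∫ x, g (T x) ∂μ = ∫ y, g y ∂ν := by
  rw [← hT.map_eq, integral_map hT.measurable.aemeasurable hg.aestronglyMeasurable]

lemma integral_sum_div (P : Measure Z) [IsProbabilityMeasure P] (hn : 1 ≤ n) {g : Z → ℝ}
    (hg : Measurable g) (hg1 : ∀ z, |g z| ≤ 1) :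
    ∫ s, (∑ i, g (s i)) / n ∂(Measure.pi fun _ : Fin n => P) = ∫ z, g z ∂P := by
  rw [integral_div, integral_finsetSum]
  · have : ∀ i : Fin n, ∫ s, g (s i) ∂(Measure.pi fun _ : Fin n => P) = ∫ z, g z ∂P := fun i =>
      integral_comp_of_measurePreserving (measurePreserving_eval (fun _ : Fin n => P) i) hg
    simp only [this, sum_const, card_univ, Fintype.card_fin, nsmul_eq_mul]
    field_simp
  · exact fun i _ => .of_bound (hg.comp (measurable_pi_apply i)).aestronglyMeasurable 1
      (.of_forall fun s => hg1 _)

variable [Nonempty ι] (P : Measure Z) [IsProbabilityMeasure P]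

lemma integrable_weightedSup (hf : ∀ h, Measurable (f h)) (hf1 : ∀ h z, |f h z| ≤ 1)
    {α : Type*} [MeasurableSpace α] {μ : Measure α} [IsFiniteMeasure μ]
    {a : α → Fin n → ℝ} {s : α → Fin n → Z} (ha : Measurable a) (ha1 : ∀ x i, |a x i| ≤ 1)
    (hs : Measurable s) : Integrable (fun x => weightedSup f (a x) (s x)) μ :=
  .of_bound (measurable_weightedSup hf ha hs).aestronglyMeasurable 1
    (.of_forall fun x => abs_weightedSup_le hf1 (ha1 x) (s x))

omit [Finite ι] [Nonempty ι] in
lemma abs_integral_le_one (hf1 : ∀ h z, |f h z| ≤ 1) (h : ι) : |∫ z, f h z ∂P| ≤ 1 := by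
  simpa using norm_integral_le_of_norm_le_const (μ := P) (f := f h) (C := 1)
    (.of_forall fun z => hf1 h z)

omit [Nonempty ι] [IsProbabilityMeasure P] in
lemma measurable_iSup_sub (hf : ∀ h, Measurable (f h)) :
    Measurable fun s : Fin n → Z => ⨆ h, (∫ z, f h z ∂P - (∑ i, f h (s i)) / n) :=
  .iSup fun h => .const_sub (.div_const (Finset.measurable_sum _ fun i _ =>
    (hf h).comp (measurable_pi_apply i)) _) _

omit [Finite ι] in
lemma abs_iSup_sub_le (hf1 : ∀ h z, |f h z| ≤ 1) (s : Fin n → Z) :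
    |⨆ h, (∫ z, f h z ∂P - (∑ i, f h (s i)) / n)| ≤ 2 :=
  abs_ciSup_le fun h => (abs_sub _ _).trans (by
    linarith [abs_integral_le_one P hf1 h, abs_sum_div_le zero_le_one fun i => hf1 h (s i)])

lemma integrable_iSup_sub (hf : ∀ h, Measurable (f h)) (hf1 : ∀ h z, |f h z| ≤ 1) :
    Integrable (fun s : Fin n → Z => ⨆ h, (∫ z, f h z ∂P - (∑ i, f h (s i)) / n))
      (Measure.pi fun _ => P) :=
  .of_bound (measurable_iSup_sub P hf).aestronglyMeasurable 2
    (.of_forall fun s => abs_iSup_sub_le P hf1 s)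

omit [Finite ι] [Nonempty ι] in
lemma integrable_sum_div (hf : ∀ h, Measurable (f h)) (hf1 : ∀ h z, |f h z| ≤ 1) (h : ι) :
    Integrable (fun s : Fin n → Z => (∑ i, f h (s i)) / (n : ℝ)) (Measure.pi fun _ => P) :=
  .of_bound (Measurable.aestronglyMeasurable (.div_const (Finset.measurable_sum _ fun i _ =>
    (hf h).comp (measurable_pi_apply i)) _)) 1
    (.of_forall fun s => abs_sum_div_le zero_le_one fun i => hf1 h (s i))

lemma integral_iSup_sub_nonneg (hn : 1 ≤ n) (hf : ∀ h, Measurable (f h))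
    (hf1 : ∀ h z, |f h z| ≤ 1) :
    0 ≤ ∫ s, ⨆ h, (∫ z, f h z ∂P - (∑ i, f h (s i)) / n) ∂(Measure.pi fun _ : Fin n => P) := by
  obtain ⟨k⟩ := ‹Nonempty ι›
  have : Nonempty ι := ⟨k⟩
  calc (0 : ℝ) = ∫ s, (∫ z, f k z ∂P - (∑ i, f k (s i)) / n)
        ∂(Measure.pi fun _ : Fin n => P) := by
        rw [integral_sub (integrable_const _) (integrable_sum_div P hf hf1 k),
          integral_sum_div P hn (hf k) (hf1 k)]
        simp
    _ ≤ _ := integral_mono ((integrable_const _).sub (integrable_sum_div P hf hf1 k))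
        (integrable_iSup_sub P hf hf1) fun s =>
          le_ciSup (f := fun h => ∫ z, f h z ∂P - (∑ i, f h (s i)) / (n : ℝ))
            (Set.finite_range _).bddAbove k

/-- Ghost sample step of the symmetrization argument. -/
lemma integral_iSup_sub_le_ghost (hn : 1 ≤ n) (hf : ∀ h, Measurable (f h))
    (hf1 : ∀ h z, |f h z| ≤ 1) :
    ∫ s, ⨆ h, (∫ z, f h z ∂P - (∑ i, f h (s i)) / n) ∂(Measure.pi fun _ : Fin n => P)
      ≤ ∫ w : Fin n → Z × Z, ⨆ h, (∑ i, (f h (w i).2 - f h (w i).1)) / n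
          ∂(Measure.pi fun _ => P.prod P) := by
  set D : (Fin n → Z) × (Fin n → Z) → ℝ := fun p => ⨆ h, (∑ i, (f h (p.2 i) - f h (p.1 i))) / n
  have hDm : Measurable D := .iSup fun h => .div_const (Finset.measurable_sum _ fun i _ =>
    ((hf h).comp (by fun_prop)).sub ((hf h).comp (by fun_prop))) _
  have hD1 : ∀ (p : (Fin n → Z) × (Fin n → Z)) h,
      |(∑ i, (f h (p.2 i) - f h (p.1 i))) / (n : ℝ)| ≤ 2 := fun p h =>
    abs_sum_div_le zero_le_two fun i => (abs_sub _ _).trans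
      (by linarith [hf1 h (p.2 i), hf1 h (p.1 i)])
  have hDint : Integrable D ((Measure.pi fun _ => P).prod (Measure.pi fun _ => P)) :=
    .of_bound hDm.aestronglyMeasurable 2 (.of_forall fun p => abs_ciSup_le (hD1 p))
  have hT := measurePreserving_arrowProdEquivProdArrow Z Z (Fin n) (fun _ => P) (fun _ => P)
  have hrw : ∫ w : Fin n → Z × Z, ⨆ h, (∑ i, (f h (w i).2 - f h (w i).1)) / n
      ∂(Measure.pi fun _ => P.prod P)
      = ∫ p, D p ∂((Measure.pi fun _ => P).prod (Measure.pi fun _ => P)) :=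
    hT.integral_comp' D
  rw [hrw, integral_prod _ hDint]
  refine integral_mono (integrable_iSup_sub P hf hf1) hDint.integral_prod_left fun s =>
    ciSup_le fun h => ?_
  have hDs : Integrable (fun s' => D (s, s')) (Measure.pi fun _ => P) :=
    .of_bound (hDm.comp (by fun_prop)).aestronglyMeasurable 2
      (.of_forall fun s' => abs_ciSup_le (hD1 (s, s')))
  have hav := integrable_sum_div (n := n) P hf hf1 h
  calc ∫ z, f h z ∂P - (∑ i, f h (s i)) / n
      = ∫ s', ((∑ i, f h (s' i)) / n - (∑ i, f h (s i)) / n) ∂(Measure.pi fun _ => P) := by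
        rw [integral_sub hav (integrable_const _), integral_sum_div P hn (hf h) (hf1 h)]
        simp
    _ ≤ ∫ s', D (s, s') ∂(Measure.pi fun _ => P) := by
        refine integral_mono (hav.sub (integrable_const _)) hDs fun s' => ?_
        have := le_ciSup (f := fun h => (∑ i, (f h (s' i) - f h (s i))) / (n : ℝ))
          (Set.finite_range _).bddAbove h
        rwa [sum_sub_distrib, sub_div] at this

/-- Sign step of the symmetrization argument: for fixed signs, swap the pairs with sign `-1`. -/
lemma integral_ghost_le (hf : ∀ h, Measurable (f h)) (hf1 : ∀ h z, |f h z| ≤ 1)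
    (σ : Fin n → Bool) :
    ∫ w : Fin n → Z × Z, ⨆ h, (∑ i, (f h (w i).2 - f h (w i).1)) / n
        ∂(Measure.pi fun _ => P.prod P)
      ≤ ∫ s, weightedSup f (fun i => boolSign (σ i)) s ∂(Measure.pi fun _ => P)
        + ∫ s, weightedSup f (fun i => boolSign (!σ i)) s ∂(Measure.pi fun _ => P) := by
  have hswap : MeasurePreserving
      (fun (w : Fin n → Z × Z) i => (if σ i then id else Prod.swap) (w i))
      (Measure.pi fun _ => P.prod P) (Measure.pi fun _ => P.prod P) := by
    refine measurePreserving_pi _ _ fun i => ?_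
    split_ifs
    · exact .id _
    · exact Measure.measurePreserving_swap
  have hfst : MeasurePreserving (fun (w : Fin n → Z × Z) i => (w i).1)
      (Measure.pi fun _ => P.prod P) (Measure.pi fun _ => P) :=
    measurePreserving_pi _ _ fun i => measurePreserving_fst
  have hsnd : MeasurePreserving (fun (w : Fin n → Z × Z) i => (w i).2)
      (Measure.pi fun _ => P.prod P) (Measure.pi fun _ => P) :=
    measurePreserving_pi _ _ fun i => measurePreserving_snd
  have hDm : Measurable fun w : Fin n → Z × Z =>
      ⨆ h, (∑ i, (f h (w i).2 - f h (w i).1)) / (n : ℝ) :=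
    .iSup fun h => .div_const (Finset.measurable_sum _ fun i _ =>
      ((hf h).comp (by fun_prop)).sub ((hf h).comp (by fun_prop))) _
  have hDint : Integrable (fun w : Fin n → Z × Z =>
      ⨆ h, (∑ i, (f h (w i).2 - f h (w i).1)) / (n : ℝ)) (Measure.pi fun _ => P.prod P) :=
    .of_bound hDm.aestronglyMeasurable 2 (.of_forall fun w => abs_ciSup_le fun h =>
      abs_sum_div_le zero_le_two fun i => (abs_sub _ _).trans
        (by linarith [hf1 h (w i).2, hf1 h (w i).1]))
  have hint : ∀ (τ : Fin n → Bool) {s : (Fin n → Z × Z) → Fin n → Z}, Measurable s →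
      Integrable (fun w => weightedSup f (fun i => boolSign (τ i)) (s w))
        (Measure.pi fun _ => P.prod P) := fun τ s hs =>
    integrable_weightedSup hf hf1 measurable_const (fun _ i => (abs_boolSign _).le) hs
  have hT : ∀ τ : Fin n → Bool, Measurable (weightedSup f fun i => boolSign (τ i)) := fun τ =>
    measurable_weightedSup hf measurable_const measurable_id
  rw [← integral_comp_of_measurePreserving hswap hDm,
    ← integral_comp_of_measurePreserving hsnd (hT σ),
    ← integral_comp_of_measurePreserving hfst (hT fun i => !σ i),
    ← integral_add (hint σ hsnd.measurable) (hint (fun i => !σ i) hfst.measurable)]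
  refine integral_mono (hswap.integrable_comp_of_integrable hDint)
    ((hint σ hsnd.measurable).add (hint (fun i => !σ i) hfst.measurable)) fun w =>
      ciSup_le fun h => ?_
  have h1 := le_ciSup (f := fun h => (∑ i, boolSign (σ i) * f h (w i).2) / (n : ℝ))
    (Set.finite_range _).bddAbove h
  have h2 := le_ciSup (f := fun h => (∑ i, boolSign (!σ i) * f h (w i).1) / (n : ℝ))
    (Set.finite_range _).bddAbove h
  refine le_trans (le_of_eq ?_) (add_le_add h1 h2)
  rw [← add_div, ← sum_add_distrib]
  congr 1
  refine sum_congr rfl fun i _ => ?_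
  by_cases hσ : σ i = true
  · simp [boolSign, hσ, sub_eq_add_neg]
  · simp [boolSign, hσ, sub_eq_neg_add]

/-- **Symmetrization**: the expected uniform deviation is at most twice the Rademacher
complexity. -/
lemma integral_iSup_sub_le (hn : 1 ≤ n) (hf : ∀ h, Measurable (f h))
    (hf1 : ∀ h z, |f h z| ≤ 1) :
    ∫ s, ⨆ h, (∫ z, f h z ∂P - (∑ i, f h (s i)) / n) ∂(Measure.pi fun _ : Fin n => P)
      ≤ 2 * ∫ p : (Fin n → Z) × (Fin n → Bool), weightedSup f (fun i => boolSign (p.2 i)) p.1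
          ∂((Measure.pi fun _ => P).prod
            (Measure.pi fun _ => (PMF.uniformOfFintype Bool).toMeasure)) := by
  set U := Measure.pi fun _ : Fin n => (PMF.uniformOfFintype Bool).toMeasure
  set T : (Fin n → Bool) → ℝ := fun σ =>
    ∫ s, weightedSup f (fun i => boolSign (σ i)) s ∂(Measure.pi fun _ => P)
  have hsign : Measurable fun (p : (Fin n → Z) × (Fin n → Bool)) i => boolSign (p.2 i) :=
    measurable_pi_lambda _ fun i => (measurable_of_finite boolSign).comp (by fun_prop)
  have hint := integrable_weightedSup (μ := (Measure.pi fun _ => P).prod U) hf hf1 hsign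
    (fun _ _ => (abs_boolSign _).le) measurable_fst
  have hR : ∫ p : (Fin n → Z) × (Fin n → Bool), weightedSup f (fun i => boolSign (p.2 i)) p.1
      ∂((Measure.pi fun _ => P).prod U) = ∫ σ, T σ ∂U := integral_prod_symm _ hint
  have hnot : ∫ σ, T (fun i => !σ i) ∂U = ∫ σ, T σ ∂U :=
    integral_comp_of_measurePreserving
      (measurePreserving_pi _ _ fun _ => measurePreserving_not) (measurable_of_finite T)
  refine (integral_iSup_sub_le_ghost P hn hf hf1).trans ?_
  set E := ∫ w : Fin n → Z × Z, ⨆ h, (∑ i, (f h (w i).2 - f h (w i).1)) / n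
    ∂(Measure.pi fun _ => P.prod P)
  calc E = ∫ _, E ∂U := by simp
    _ ≤ ∫ σ, (T σ + T (fun i => !σ i)) ∂U :=
        integral_mono (integrable_const _) .of_finite fun σ => integral_ghost_le P hf hf1 σ
    _ = 2 * ∫ σ, T σ ∂U := by rw [integral_add .of_finite .of_finite, hnot, two_mul]
    _ = _ := by rw [hR]

omit [MeasurableSpace Z] in
/-- Replacing one sample point changes an average of `[0, 1]`-valued terms by at most `1 / n`. -/
lemma abs_sum_update_sub_le {g : Z → ℝ} (hg : ∀ z, g z ∈ Set.Icc (0 : ℝ) 1)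
    (s : Fin n → Z) (i : Fin n) (z : Z) :
    |(∑ j, g (Function.update s i z j)) / n - (∑ j, g (s j)) / n| ≤ 1 / (n : ℝ) := by
  have hsum : ∑ j, g (Function.update s i z j) - ∑ j, g (s j) = g z - g (s i) := by
    rw [← sum_sub_distrib, Finset.sum_eq_single i (fun j _ hj => by simp [hj]) (by simp)]
    simp
  rw [← sub_div, hsum, abs_div, Nat.abs_cast]
  gcongr
  exact abs_sub_le_iff.2 ⟨by linarith [(hg z).2, (hg (s i)).1],
    by linarith [(hg z).1, (hg (s i)).2]⟩

/-- High-probability bound on the excess risk, for classes of `[0, 1]`-valued functions: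
with `k` a fixed reference element, the uniform deviation of the class plus the deviation of `k`
is controlled by the Rademacher complexity. -/
lemma measureReal_uniform_deviation_ge_le (hn : 1 ≤ n) (hf : ∀ h, Measurable (f h))
    (hf1 : ∀ h z, f h z ∈ Set.Icc (0 : ℝ) 1) (k : ι) {ε : ℝ} (hε : 0 ≤ ε) :
    (Measure.pi fun _ : Fin n => P).real
      {s | 2 * (∫ p : (Fin n → Z) × (Fin n → Bool), weightedSup f (fun i => boolSign (p.2 i)) p.1
          ∂((Measure.pi fun _ => P).prod
            (Measure.pi fun _ => (PMF.uniformOfFintype Bool).toMeasure))) + ε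
        ≤ (⨆ h, (∫ z, f h z ∂P - (∑ i, f h (s i)) / n))
          + ((∑ i, f k (s i)) / n - ∫ z, f k z ∂P)}
      ≤ Real.exp (-(n * ε ^ 2 / 2)) := by
  have hf_abs : ∀ h z, |f h z| ≤ 1 := fun h z =>
    abs_le.2 ⟨by linarith [(hf1 h z).1], (hf1 h z).2⟩
  set R := ∫ p : (Fin n → Z) × (Fin n → Bool), weightedSup f (fun i => boolSign (p.2 i)) p.1
    ∂((Measure.pi fun _ => P).prod (Measure.pi fun _ => (PMF.uniformOfFintype Bool).toMeasure))
  set G : (Fin n → Z) → ℝ := fun s => ⨆ h, (∫ z, f h z ∂P - (∑ i, f h (s i)) / n) with hG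
  set K : (Fin n → Z) → ℝ := fun s => (∑ i, f k (s i)) / n with hK
  have hLabs := abs_integral_le_one P hf_abs k
  have hKabs : ∀ s, |K s| ≤ 1 := fun s => abs_sum_div_le zero_le_one fun i => hf_abs k (s i)
  have hGabs : ∀ s, |G s| ≤ 2 := abs_iSup_sub_le P hf_abs
  have hGm : Measurable G := measurable_iSup_sub P hf
  have hKm : Measurable K := .div_const (Finset.measurable_sum _ fun i _ =>
    (hf k).comp (measurable_pi_apply i)) _
  have hmean : ∫ s, (G s + (K s - ∫ z, f k z ∂P)) ∂(Measure.pi fun _ => P) ≤ 2 * R := by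
    have hKint : Integrable K (Measure.pi fun _ => P) := integrable_sum_div P hf hf_abs k
    have hK0 : ∫ s, (K s - ∫ z, f k z ∂P) ∂(Measure.pi fun _ => P) = 0 := by
      rw [integral_sub hKint (integrable_const _), integral_sum_div P hn (hf k) (hf_abs k)]
      simp
    have hsum := integral_add (f := G) (g := fun s => K s - ∫ z, f k z ∂P)
      (integrable_iSup_sub P hf hf_abs) (hKint.sub (integrable_const _))
    rw [hsum, hK0, add_zero]
    exact integral_iSup_sub_le P hn hf hf_abs
  have hdiff : ∀ s i z, (G (Function.update s i z) + (K (Function.update s i z) - ∫ z, f k z ∂P))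
      - (G s + (K s - ∫ z, f k z ∂P)) ≤ ((2 / n : ℝ≥0) : ℝ) := fun s i z => by
    have h1 : G (Function.update s i z) ≤ G s + 1 / n := ciSup_le fun h => by
      have h2 := le_ciSup (f := fun h => ∫ z, f h z ∂P - (∑ i, f h (s i)) / (n : ℝ))
        (Set.finite_range _).bddAbove h
      have h3 := abs_le.1 (abs_sum_update_sub_le (hf1 h) s i z)
      simp only [hG]
      linarith
    have h4 := abs_le.1 (abs_sum_update_sub_le (hf1 k) s i z)
    have h5 : ((2 / n : ℝ≥0) : ℝ) = 1 / n + 1 / n := by push_cast; ring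
    simp only [hK]
    linarith
  have hsub := hasSubgaussianMGF_of_bounded_differences P
    (f := fun s => G s + (K s - ∫ z, f k z ∂P)) (hGm.add (hKm.sub_const _)) (C := 4)
    (fun s => abs_le.2 (by
      have h1 := abs_le.1 (hGabs s)
      have h2 := abs_le.1 (hKabs s)
      have h3 := abs_le.1 hLabs
      constructor <;> linarith)) (fun _ => 2 / n) hdiff
  refine (measureReal_mono fun s hs => ?_).trans ((hsub.measure_ge_le hε).trans_eq ?_)
  · simp only [Set.mem_ofPred_eq] at hs ⊢
    linarith
  · have : (n : ℝ) ≠ 0 := by positivity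
    simp only [sum_const, card_univ, Fintype.card_fin, nsmul_eq_mul]
    push_cast
    congr 1
    field_simp

end Symmetrization

/-- Classical Rademacher bound for the zero-one loss class. -/
theorem rademacher_bound {n : ℕ} (hn : 1 ≤ n)
    (P : Measure (X × Y)) [IsProbabilityMeasure P]
    (H : Finset (X → Y)) (hH : H.Nonempty)
    (hmeas : ∀ h ∈ H, MeasurableSet (errSet h))
    (erm : (Fin n → X × Y) → (X → Y)) (hermM : MeasurableERM erm) (herm : IsERM H erm)
    (hstar : X → Y) (hstarH : hstar ∈ H) (hstarmin : ∀ h ∈ H, risk P hstar ≤ risk P h)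
    (δ : ℝ) (hδ : δ ∈ Set.Ioo (0 : ℝ) 1) :
    (Measure.pi fun _ : Fin n => P)
        {s | risk P (erm s) - risk P hstar
          ≤ 4 * rademacher n P H + Real.sqrt (2 * Real.log (2 / δ) / n)}
      ≥ ENNReal.ofReal (1 - δ) := by
  have hnR : (0 : ℝ) < n := by exact_mod_cast hn
  have : Nonempty H := hH.to_subtype
  set f : H → X × Y → ℝ := fun h z => if z.2 ≠ (h : X → Y) z.1 then 1 else 0 with hf_def
  have hf_ind : ∀ h, f h = (errSet (h : X → Y)).indicator 1 := fun h => by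
    funext z
    simp [hf_def, errSet, Set.indicator_apply]
  have hf : ∀ h, Measurable (f h) := fun h => by
    rw [hf_ind]; exact measurable_one.indicator (hmeas h h.2)
  have hf1 : ∀ h z, f h z ∈ Set.Icc (0 : ℝ) 1 := fun h z => by
    simp only [hf_def]; split_ifs <;> simp
  have hrisk : ∀ h : H, ∫ z, f h z ∂P = risk P h := fun h => by
    rw [hf_ind, integral_indicator_one (hmeas h h.2)]; rfl
  have hemp : ∀ (h : H) (s : Fin n → X × Y), (∑ i, f h (s i)) / n = empRisk s h := fun h s => by
    simp only [hf_def, empRisk, sum_boole]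
  have hR : ∫ p : (Fin n → X × Y) × (Fin n → Bool), weightedSup f (fun i => boolSign (p.2 i)) p.1
      ∂((Measure.pi fun _ => P).prod
        (Measure.pi fun _ => (PMF.uniformOfFintype Bool).toMeasure)) = rademacher n P H := rfl
  have hR0 : 0 ≤ rademacher n P H := by
    have hf_abs : ∀ h z, |f h z| ≤ 1 := fun h z =>
      abs_le.2 ⟨by linarith [(hf1 h z).1], (hf1 h z).2⟩
    have h1 := (integral_iSup_sub_nonneg P hn hf hf_abs).trans
      (integral_iSup_sub_le P hn hf hf_abs)
    rw [hR] at h1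
    linarith
  set ε := Real.sqrt (2 * Real.log (2 / δ) / n) with hε
  have hlog : 0 ≤ Real.log (2 / δ) :=
    Real.log_nonneg ((one_le_div hδ.1).2 (by linarith [hδ.2]))
  have htail := measureReal_uniform_deviation_ge_le P hn hf hf1 ⟨hstar, hstarH⟩
    (Real.sqrt_nonneg _ : 0 ≤ ε)
  rw [hR] at htail
  simp only [hrisk, hemp] at htail
  have hexp : Real.exp (-(n * ε ^ 2 / 2)) = δ / 2 := by
    rw [hε, Real.sq_sqrt (by positivity)]
    have : (n : ℝ) * (2 * Real.log (2 / δ) / n) / 2 = Real.log (2 / δ) := by field_simp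
    rw [this, Real.exp_neg, Real.exp_log (by have := hδ.1; positivity), inv_div]
  rw [hexp] at htail
  set B := {s : Fin n → X × Y | 2 * rademacher n P H + ε
    ≤ (⨆ h : H, (risk P h - empRisk s h)) + (empRisk s hstar - risk P hstar)} with hB
  have hsub : Bᶜ ⊆ {s | risk P (erm s) - risk P hstar ≤ 4 * rademacher n P H + ε} := fun s hs => by
    simp only [hB, Set.mem_compl_iff, Set.mem_ofPred_eq, not_le] at hs ⊢
    have h1 := le_ciSup (f := fun h : H => risk P h - empRisk s h)
      (Set.finite_range _).bddAbove ⟨erm s, (herm s).1⟩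
    have h2 := (herm s).2 hstar hstarH
    simp only at h1
    linarith
  refine ge_iff_le.2 (le_trans ?_ (measure_mono hsub))
  have hone : 1 ≤ (Measure.pi fun _ : Fin n => P).real B
      + (Measure.pi fun _ : Fin n => P).real Bᶜ := by
    simpa [Set.union_compl_self] using
      measureReal_union_le (μ := Measure.pi fun _ : Fin n => P) B Bᶜ
  refine ENNReal.ofReal_le_of_le_toReal ?_
  change _ ≤ (Measure.pi fun _ : Fin n => P).real Bᶜ
  linarith [hδ.1]
end
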